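/- arXiv:1608.06613 — 9 statements merged into one kernel-verified Lean document; each statement's English description precedes it below -/
import Mathlib

section
/- Let Ω be a convex subset of a real normed vector space, let f : Ω → ℝ, and let x, y ∈ Ω with f Fréchet differentiable at y with derivative ∇f(y). Then the α-divergence D_f^α(x,y) = (4/(1−α²)) [ ((1−α)/2) f(x) + ((1+α)/2) f(y) − f( ((1−α)/2) x + ((1+α)/2) y ) ] converges, as α → 1⁻, to the Bregman divergence B_f(x,y) = f(x) − f(y) − ⟨∇f(y), x − y⟩. -/
/-- As `α → 1⁻`, the α-divergence `D_f^α(x,y)` converges to the Bregman divergence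
`B_f(x,y) = f(x) − f(y) − ⟨∇f(y), x − y⟩`. -/
theorem alphaDiv_tendsto_bregman {E : Type*} [NormedAddCommGroup E] [NormedSpace ℝ E]
    (Ω : Set E) (hΩ : Convex ℝ Ω) (f : E → ℝ) (x y : E) (hx : x ∈ Ω) (hy : y ∈ Ω)
    (φ : E →L[ℝ] ℝ) (hf : HasFDerivWithinAt f φ Ω y) :
    Filter.Tendsto
      (fun α : ℝ => (4 / (1 - α ^ 2)) *
        (((1 - α) / 2) * f x + ((1 + α) / 2) * f y
          - f (((1 - α) / 2) • x + ((1 + α) / 2) • y)))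
      (nhdsWithin 1 (Set.Iio (1 : ℝ)))
      (nhds (f x - f y - φ (x - y))) := by
  have hline : HasDerivWithinAt (fun t : ℝ => f (y + t • (x - y))) (φ (x - y))
      ((fun t : ℝ => y + t • (x - y)) ⁻¹' Ω) 0 :=
    hf.hasLineDerivWithinAt (x - y)
  rw [hasDerivWithinAt_iff_tendsto_slope] at hline
  have hweight : Filter.Tendsto (fun α : ℝ => (1 - α) / 2) (nhdsWithin 1 (Set.Iio 1))
      (nhds 0) := by
    have h : ContinuousAt (fun α : ℝ => (1 - α) / 2) 1 := by fun_prop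
    simpa [ContinuousAt] using h.tendsto.mono_left nhdsWithin_le_nhds
  have hIoo : ∀ᶠ α : ℝ in nhdsWithin 1 (Set.Iio 1), α ∈ Set.Ioo (-1 : ℝ) 1 :=
    Ioo_mem_nhdsLT (by norm_num)
  have hpoint (α : ℝ) :
      y + ((1 - α) / 2) • (x - y) = ((1 - α) / 2) • x + ((1 + α) / 2) • y := by
    module
  have hwithin : Filter.Tendsto (fun α : ℝ => (1 - α) / 2) (nhdsWithin 1 (Set.Iio 1))
      (nhdsWithin 0 ((fun t : ℝ => y + t • (x - y)) ⁻¹' Ω \ {0})) := by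
    refine tendsto_nhdsWithin_iff.2 ⟨hweight, ?_⟩
    filter_upwards [hIoo] with α ⟨hα₁, hα₂⟩
    refine ⟨?_, ?_⟩
    · rw [Set.mem_preimage, hpoint]
      exact hΩ hx hy (by linarith) (by linarith) (by ring)
    · rw [Set.mem_singleton_iff]
      linarith
  have hslope := hline.comp hwithin
  have hfactor : Filter.Tendsto (fun α : ℝ => 2 / (1 + α)) (nhdsWithin 1 (Set.Iio 1))
      (nhds 1) := by
    have h : ContinuousAt (fun α : ℝ => 2 / (1 + α)) 1 := by
      fun_prop (disch := norm_num)
    have h' := h.tendsto.mono_left (nhdsWithin_le_nhds (s := Set.Iio 1))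
    norm_num at h'
    exact h'
  have hlim := hfactor.mul (hslope.const_sub (f x - f y))
  rw [one_mul] at hlim
  refine hlim.congr' ?_
  filter_upwards [hIoo] with α ⟨hα₁, hα₂⟩
  have hsub : 1 - α ≠ 0 := by linarith
  have hadd : 1 + α ≠ 0 := by linarith
  have hsq : 1 - α ^ 2 = (1 - α) * (1 + α) := by ring
  simp only [Function.comp_apply, slope_def_field, hpoint, zero_smul, add_zero, sub_zero, hsq]
  field_simp
  ring
end

section
/- Let Ω be a convex subset of a real normed vector space, let f : Ω → ℝ, and let x, y ∈ Ω with f Fréchet differentiable at x with derivative ∇f(x). Then the α-divergence D_f^α(x,y) = (4/(1−α²)) [ ((1−α)/2) f(x) + ((1+α)/2) f(y) − f( ((1−α)/2) x + ((1+α)/2) y ) ] converges, as α → −1⁺, to B_f(y,x) = f(y) − f(x) − ⟨∇f(x), y − x⟩. -/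
/-- As `α → −1⁺`, the α-divergence `D_f^α(x,y)` converges to
`B_f(y,x) = f(y) − f(x) − ⟨∇f(x), y − x⟩`. -/
theorem alphaDiv_tendsto_bregman_swap {E : Type*} [NormedAddCommGroup E] [NormedSpace ℝ E]
    (Ω : Set E) (hΩ : Convex ℝ Ω) (f : E → ℝ) (x y : E) (hx : x ∈ Ω) (hy : y ∈ Ω)
    (φ : E →L[ℝ] ℝ) (hf : HasFDerivWithinAt f φ Ω x) :
    Filter.Tendsto
      (fun α : ℝ => (4 / (1 - α ^ 2)) *
        (((1 - α) / 2) * f x + ((1 + α) / 2) * f y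
          - f (((1 - α) / 2) • x + ((1 + α) / 2) • y)))
      (nhdsWithin (-1) (Set.Ioi (-1 : ℝ)))
      (nhds (f y - f x - φ (y - x))) := by
  set g : ℝ → ℝ := f ∘ AffineMap.lineMap x y with hg
  have hderiv : HasDerivWithinAt g (φ (y - x)) (Set.Icc 0 1) 0 := by
    refine HasFDerivWithinAt.comp_hasDerivWithinAt (t := Ω) (0 : ℝ) (by simpa using hf)
      AffineMap.hasDerivWithinAt_lineMap ?_
    intro t ht
    exact hΩ.lineMap_mem hx hy ht
  have hparam : Filter.Tendsto (fun α : ℝ => (1 + α) / 2) (nhdsWithin (-1) (Set.Ioi (-1)))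
      (nhdsWithin 0 (Set.Icc 0 1 \ {0})) := by
    refine tendsto_nhdsWithin_iff.2 ⟨?_, ?_⟩
    · have h : Continuous fun α : ℝ => (1 + α) / 2 := by fun_prop
      simpa using (h.tendsto (-1)).mono_left nhdsWithin_le_nhds
    · filter_upwards [Ioo_mem_nhdsGT (show (-1 : ℝ) < 1 by norm_num)] with α hα
      have h₁ := hα.1
      have h₂ := hα.2
      refine ⟨⟨by linarith, by linarith⟩, fun h => ?_⟩
      have h₀ : (1 + α) / 2 = 0 := h
      linarith
  have hslope := (hasDerivWithinAt_iff_tendsto_slope.1 hderiv).comp hparam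
  have hfactor : Filter.Tendsto (fun α : ℝ => 2 / (1 - α)) (nhdsWithin (-1) (Set.Ioi (-1)))
      (nhds 1) := by
    have h : ContinuousAt (fun α : ℝ => 2 / (1 - α)) (-1) := by
      fun_prop (disch := norm_num)
    have h₁ : (2 : ℝ) / (1 - -1) = 1 := by norm_num
    simpa only [h₁] using h.tendsto.mono_left nhdsWithin_le_nhds
  have hlim := hfactor.mul (hslope.const_sub (f y - f x))
  rw [one_mul] at hlim
  refine hlim.congr' ?_
  filter_upwards [Ioo_mem_nhdsGT (show (-1 : ℝ) < 1 by norm_num)] with α hα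
  have hpos : 1 + α ≠ 0 := by linarith [hα.1]
  have hneg : 1 - α ≠ 0 := by linarith [hα.2]
  have hpoint : g ((1 + α) / 2) = f (((1 - α) / 2) • x + ((1 + α) / 2) • y) := by
    rw [hg, Function.comp_apply, AffineMap.lineMap_apply_module]
    congr 3
    ring
  have hzero : g 0 = f x := by simp [hg]
  have hsq : 1 - α ^ 2 = (1 - α) * (1 + α) := by ring
  rw [Function.comp_apply, slope_def_field, hpoint, hzero, hsq, sub_zero]
  field_simp
  ring
end

section
/- (Ky Fan determinant inequality) Let A and B be n×n Hermitian positive-definite complex matrices and let λ ∈ [0,1]. Then det(λA + (1−λ)B) ≥ (det A)^λ (det B)^{1−λ}, where both sides are positive real numbers. -/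
open scoped ComplexOrder Matrix

open scoped MatrixOrder in
/-- Two positive-definite matrices are simultaneously diagonalized by a congruence that takes the
second one to the identity. -/
theorem Matrix.PosDef.exists_simultaneous_diagonalization {ι : Type*} [Fintype ι] [DecidableEq ι]
    {A B : Matrix ι ι ℂ} (hA : A.PosDef) (hB : B.PosDef) :
    ∃ (X : Matrix ι ι ℂ) (d : ι → ℝ), (∀ i, 0 < d i) ∧
      A = Xᴴ * Matrix.diagonal (fun i ↦ (d i : ℂ)) * X ∧ B = Xᴴ * X := by
  obtain ⟨C, hC, hBC⟩ := CStarAlgebra.isStrictlyPositive_iff_eq_star_mul_self.mp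
    (Matrix.isStrictlyPositive_iff_posDef.mpr hB)
  rw [Matrix.star_eq_conjTranspose] at hBC
  have hdet : IsUnit C.det := (Matrix.isUnit_iff_isUnit_det C).mp hC
  have hD : (C⁻¹ᴴ * A * C⁻¹).PosDef := by
    refine hA.conjTranspose_mul_mul_same (Matrix.mulVec_injective_iff_isUnit.mpr ?_)
    exact (Matrix.isUnit_nonsing_inv_iff).mpr hC
  let U : Matrix ι ι ℂ := hD.isHermitian.eigenvectorUnitary.val
  have hUU : U * Uᴴ = 1 := Unitary.coe_mul_star_self _
  have hspec : C⁻¹ᴴ * A * C⁻¹ =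
      U * Matrix.diagonal (fun i ↦ (hD.isHermitian.eigenvalues i : ℂ)) * Uᴴ := by
    conv_lhs => rw [hD.isHermitian.spectral_theorem, Unitary.conjStarAlgAut_apply]
    rfl
  refine ⟨Uᴴ * C, hD.isHermitian.eigenvalues, hD.eigenvalues_pos, ?_, ?_⟩
  · calc A = (C⁻¹ * C)ᴴ * A * (C⁻¹ * C) := by simp [Matrix.nonsing_inv_mul C hdet]
      _ = Cᴴ * (C⁻¹ᴴ * A * C⁻¹) * C := by
        simp only [Matrix.conjTranspose_mul, Matrix.mul_assoc]
      _ = Cᴴ * (U * Matrix.diagonal (fun i ↦ (hD.isHermitian.eigenvalues i : ℂ)) * Uᴴ) * C :=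
        congrArg (Cᴴ * · * C) hspec
      _ = _ := by
        simp only [Matrix.conjTranspose_mul, Matrix.conjTranspose_conjTranspose, Matrix.mul_assoc]
  · rw [Matrix.conjTranspose_mul, Matrix.conjTranspose_conjTranspose, Matrix.mul_assoc,
      ← Matrix.mul_assoc U, hUU, Matrix.one_mul, hBC]

/-- The determinant of a matrix congruent to a real diagonal matrix. -/
theorem Matrix.det_conjTranspose_mul_diagonal_mul {ι : Type*} [Fintype ι] [DecidableEq ι]
    (X : Matrix ι ι ℂ) (d : ι → ℝ) :
    (Xᴴ * Matrix.diagonal (fun i ↦ (d i : ℂ)) * X).det =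
      ((Complex.normSq X.det * ∏ i, d i : ℝ) : ℂ) := by
  rw [Matrix.det_mul, Matrix.det_mul, Matrix.det_conjTranspose, Matrix.det_diagonal,
    mul_right_comm, Complex.star_def, ← Complex.normSq_eq_conj_mul_self]
  push_cast
  rfl

/-- Ky Fan determinant inequality: for Hermitian positive-definite `A, B` and `λ ∈ [0,1]`,
`det(λA + (1−λ)B) ≥ (det A)^λ (det B)^{1−λ}`, all quantities being positive reals. -/
theorem kyFan_det_inequality (n : ℕ) (A B : Matrix (Fin n) (Fin n) ℂ)
    (hA : A.PosDef) (hB : B.PosDef) (l : ℝ) (hl : l ∈ Set.Icc (0 : ℝ) 1) :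
    0 < A.det.re ∧ 0 < B.det.re ∧ 0 < (l • A + (1 - l) • B).det.re ∧
      A.det.re ^ l * B.det.re ^ (1 - l) ≤ (l • A + (1 - l) • B).det.re := by
  have hA' : 0 < A.det.re := (Complex.pos_iff.mp hA.det_pos).1
  have hB' : 0 < B.det.re := (Complex.pos_iff.mp hB.det_pos).1
  suffices h : A.det.re ^ l * B.det.re ^ (1 - l) ≤ (l • A + (1 - l) • B).det.re from
    ⟨hA', hB', (by positivity : 0 < A.det.re ^ l * B.det.re ^ (1 - l)).trans_le h, h⟩
  obtain ⟨X, d, hd, hAX, hBX⟩ := hA.exists_simultaneous_diagonalization hB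
  have hsum : l • A + (1 - l) • B =
      Xᴴ * Matrix.diagonal (fun i ↦ ((l * d i + (1 - l) : ℝ) : ℂ)) * X := by
    have hdiag : Matrix.diagonal (fun i ↦ ((l * d i + (1 - l) : ℝ) : ℂ)) =
        l • Matrix.diagonal (fun i ↦ (d i : ℂ)) + (1 - l) • (1 : Matrix (Fin n) (Fin n) ℂ) := by
      ext i j
      by_cases hij : i = j <;> simp [hij]
    rw [hdiag, hAX, hBX]
    simp [Matrix.mul_add, Matrix.add_mul]
  have hdetA : A.det.re = Complex.normSq X.det * ∏ i, d i := by
    rw [hAX, Matrix.det_conjTranspose_mul_diagonal_mul, Complex.ofReal_re]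
  have hdetB : B.det.re = Complex.normSq X.det := by
    rw [hBX, Matrix.det_mul, Matrix.det_conjTranspose, Complex.star_def,
      ← Complex.normSq_eq_conj_mul_self, Complex.ofReal_re]
  rw [hsum, Matrix.det_conjTranspose_mul_diagonal_mul, Complex.ofReal_re, hdetA, hdetB]
  rw [hdetB] at hB'
  have hprod : (∏ i, d i) ^ l ≤ ∏ i, (l * d i + (1 - l)) := by
    rw [← Real.finsetProd_rpow _ _ fun i _ ↦ (hd i).le]
    refine Finset.prod_le_prod (fun i _ ↦ Real.rpow_nonneg (hd i).le l) fun i _ ↦ ?_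
    simpa using Real.geom_mean_le_arith_mean2_weighted hl.1 (sub_nonneg.mpr hl.2) (hd i).le
      zero_le_one (add_sub_cancel l 1)
  calc (Complex.normSq X.det * ∏ i, d i) ^ l * Complex.normSq X.det ^ (1 - l)
      = Complex.normSq X.det * (∏ i, d i) ^ l := by
        rw [Real.mul_rpow hB'.le (Finset.prod_nonneg fun i _ ↦ (hd i).le), mul_right_comm,
          ← Real.rpow_add hB', add_sub_cancel, Real.rpow_one]
    _ ≤ _ := by gcongr
end

section
/- Let A be an n×n Hermitian positive-definite complex matrix and let Â = (Diag A)^{−1/2} A (Diag A)^{−1/2}. Then the right Kullback–Leibler diagonality measure D_KL^r(A) = tr(Â⁻¹) − n + log det(Â) satisfies D_KL^r(A) ≥ 0, with equality if and only if A is a diagonal matrix. -/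
open scoped ComplexOrder Matrix

namespace Matrix

variable {n : Type*} [Fintype n] [DecidableEq n]

/-- A Hermitian matrix all of whose eigenvalues are `1` is the identity. -/
theorem IsHermitian.eq_one_of_eigenvalues_eq_one {B : Matrix n n ℂ} (hB : B.IsHermitian)
    (h : ∀ i, hB.eigenvalues i = 1) : B = 1 := by
  have key := hB.spectral_theorem
  have hd : diagonal ((RCLike.ofReal : ℝ → ℂ) ∘ hB.eigenvalues) = 1 := by
    rw [← diagonal_one]
    congr 1
    ext i
    simp [h i]
  rw [hd, map_one] at key
  exact key

theorem PosDef.trace_sub_card_sub_log_det_eq_sum {B : Matrix n n ℂ} (hB : B.PosDef) :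
    B.trace.re - (Fintype.card n : ℝ) - Real.log B.det.re =
      ∑ i, (hB.1.eigenvalues i - 1 - Real.log (hB.1.eigenvalues i)) := by
  have ht : B.trace.re = ∑ i, hB.1.eigenvalues i := by
    simp [hB.1.trace_eq_sum_eigenvalues]
  have hd : B.det = ((∏ i, hB.1.eigenvalues i : ℝ) : ℂ) := by
    rw [hB.1.det_eq_prod_eigenvalues]
    push_cast
    rfl
  rw [ht, hd, Complex.ofReal_re, Real.log_prod fun i _ => (hB.eigenvalues_pos i).ne']
  simp [Finset.sum_sub_distrib]

theorem PosDef.trace_sub_card_sub_log_det_nonneg {B : Matrix n n ℂ} (hB : B.PosDef) :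
    0 ≤ B.trace.re - (Fintype.card n : ℝ) - Real.log B.det.re := by
  rw [hB.trace_sub_card_sub_log_det_eq_sum]
  exact Finset.sum_nonneg fun i _ =>
    sub_nonneg.2 (Real.log_le_sub_one_of_pos (hB.eigenvalues_pos i))

theorem PosDef.trace_sub_card_sub_log_det_eq_zero_iff {B : Matrix n n ℂ} (hB : B.PosDef) :
    B.trace.re - (Fintype.card n : ℝ) - Real.log B.det.re = 0 ↔ B = 1 := by
  refine ⟨fun h => ?_, fun h => by simp [h]⟩
  rw [hB.trace_sub_card_sub_log_det_eq_sum, Finset.sum_eq_zero_iff_of_nonneg fun i _ =>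
    sub_nonneg.2 (Real.log_le_sub_one_of_pos (hB.eigenvalues_pos i))] at h
  refine hB.1.eq_one_of_eigenvalues_eq_one fun i => ?_
  by_contra hi
  linarith [Real.log_lt_sub_one_of_pos (hB.eigenvalues_pos i) hi, h i (Finset.mem_univ i)]

theorem PosDef.log_det_inv_re {B : Matrix n n ℂ} (hB : B.PosDef) :
    Real.log (B⁻¹.det.re) = -Real.log B.det.re := by
  have hd : B.det = ((B.det.re : ℝ) : ℂ) :=
    Complex.ext rfl (by simpa using (Complex.pos_iff.1 hB.det_pos).2.symm)
  rw [det_nonsing_inv, Ring.inverse_eq_inv', hd, ← Complex.ofReal_inv, Complex.ofReal_re,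
    Complex.ofReal_re, Real.log_inv]

end Matrix

/-- The right Kullback–Leibler diagonality measure `tr(Â⁻¹) − n + log det Â` of a Hermitian
positive-definite matrix is nonnegative, and vanishes iff the matrix is diagonal. -/
theorem right_KL_diagonality_nonneg (n : ℕ) (A : Matrix (Fin n) (Fin n) ℂ) (hA : A.PosDef)
    (S Ahat : Matrix (Fin n) (Fin n) ℂ)
    (hS : S = Matrix.diagonal fun i => (((Real.sqrt ((A i i).re))⁻¹ : ℝ) : ℂ))
    (hAhat : Ahat = S * A * S) :
    0 ≤ (Ahat⁻¹).trace.re - (n : ℝ) + Real.log (Ahat.det.re) ∧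
      ((Ahat⁻¹).trace.re - (n : ℝ) + Real.log (Ahat.det.re) = 0 ↔
        A = Matrix.diagonal fun i => A i i) := by
  have hpos (i : Fin n) : 0 < (A i i).re := (Complex.pos_iff.1 hA.diag_pos).1
  have hreal (i : Fin n) : A i i = (((A i i).re : ℝ) : ℂ) :=
    Complex.ext rfl (by simpa using (Complex.pos_iff.1 (hA.diag_pos (i := i))).2.symm)
  have hsne (i : Fin n) : (((Real.sqrt ((A i i).re))⁻¹ : ℝ) : ℂ) ≠ 0 :=
    Complex.ofReal_ne_zero.2 (inv_ne_zero (Real.sqrt_pos.2 (hpos i)).ne')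
  have hentry (i j : Fin n) : Ahat i j = (((Real.sqrt ((A i i).re))⁻¹ : ℝ) : ℂ) * A i j *
      (((Real.sqrt ((A j j).re))⁻¹ : ℝ) : ℂ) := by
    rw [hAhat, hS, Matrix.mul_diagonal, Matrix.diagonal_mul]
  have hSH : Sᴴ = S := by
    rw [hS, Matrix.diagonal_conjTranspose]
    congr 1
    ext i
    simp
  have hSunit : IsUnit S := by
    rw [Matrix.isUnit_iff_isUnit_det, hS, Matrix.det_diagonal, isUnit_iff_ne_zero]
    exact Finset.prod_ne_zero_iff.2 fun i _ => hsne i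
  have hAhatPos : Ahat.PosDef := by
    have h := (Matrix.IsUnit.posDef_star_right_conjugate_iff hSunit).2 hA
    rwa [Matrix.star_eq_conjTranspose, hSH, ← hAhat] at h
  have hmeasure : (Ahat⁻¹).trace.re - (n : ℝ) + Real.log (Ahat.det.re) =
      (Ahat⁻¹).trace.re - (Fintype.card (Fin n) : ℝ) - Real.log (Ahat⁻¹.det.re) := by
    rw [hAhatPos.log_det_inv_re, Fintype.card_fin, sub_neg_eq_add]
  rw [hmeasure]
  refine ⟨hAhatPos.inv.trace_sub_card_sub_log_det_nonneg, ?_⟩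
  rw [hAhatPos.inv.trace_sub_card_sub_log_det_eq_zero_iff]
  constructor
  · intro h
    have h1 : Ahat = 1 := by
      rw [← Matrix.nonsing_inv_nonsing_inv Ahat hAhatPos.det_pos.ne'.isUnit, h, inv_one]
    ext i j
    obtain rfl | hij := eq_or_ne i j
    · simp
    · have h2 := hentry i j
      rw [h1, Matrix.one_apply_ne hij] at h2
      rw [Matrix.diagonal_apply_ne _ hij]
      simpa only [mul_eq_zero, hsne, or_false, false_or] using h2.symm
  · intro h
    have h1 : Ahat = 1 := by
      ext i j
      rw [hentry]
      obtain rfl | hij := eq_or_ne i j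
      · rw [Matrix.one_apply_eq, hreal i, Complex.ofReal_re, ← Complex.ofReal_mul,
          ← Complex.ofReal_mul, ← Complex.ofReal_one]
        congr 1
        have hs := Real.sqrt_pos.2 (hpos i)
        field_simp
        exact (Real.sq_sqrt (hpos i).le).symm
      · rw [h, Matrix.diagonal_apply_ne _ hij, Matrix.one_apply_ne hij]
        simp
    rw [h1, inv_one]
end

section
/- Let −1 < α < 1 and let A be an n×n Hermitian positive-definite complex matrix. Then the log-det α-diagonality measure D_α(A) = (4/(1−α²)) log [ det( ((1−α)/2) A + ((1+α)/2) Diag(A) ) / ( (det A)^{(1−α)/2} (det Diag A)^{(1+α)/2} ) ] is nonnegative, and it equals zero if and only if A is a diagonal matrix. -/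
open scoped ComplexOrder Matrix

namespace Matrix

variable {ι : Type*} [Fintype ι] [DecidableEq ι]

theorem IsHermitian.det_smul_add_smul_one {C : Matrix ι ι ℂ} (hC : C.IsHermitian) (s t : ℝ) :
    (s • C + t • (1 : Matrix ι ι ℂ)).det = ((∏ i, (s * hC.eigenvalues i + t) : ℝ) : ℂ) := by
  have key : s • C + t • (1 : Matrix ι ι ℂ) =
      Unitary.conjStarAlgAut ℂ _ hC.eigenvectorUnitary
        (diagonal fun i => ((s * hC.eigenvalues i + t : ℝ) : ℂ)) := by
    have hdiag : (diagonal fun i => ((s * hC.eigenvalues i + t : ℝ) : ℂ)) =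
        (s : ℂ) • diagonal (RCLike.ofReal ∘ hC.eigenvalues) + (t : ℂ) • (1 : Matrix ι ι ℂ) := by
      ext i j
      by_cases h : i = j
      · subst h; simp
      · simp [h]
    rw [hdiag, map_add, map_smul, map_smul, map_one, ← hC.spectral_theorem]
    ext i j
    simp
  rw [key, Unitary.conjStarAlgAut_apply, det_mul_right_comm,
    Unitary.mul_star_self_of_mem hC.eigenvectorUnitary.2, one_mul,
    det_diagonal, Complex.ofReal_prod]

theorem IsHermitian.eq_one_of_eigenvalues {C : Matrix ι ι ℂ} (hC : C.IsHermitian)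
    (h : ∀ i, hC.eigenvalues i = 1) : C = 1 := by
  have hdiag : diagonal (RCLike.ofReal ∘ hC.eigenvalues) = (1 : Matrix ι ι ℂ) := by
    rw [← diagonal_one]
    congr 1
    ext i
    simp [h]
  rw [hC.spectral_theorem, hdiag, map_one]

theorem PosDef.det_re_pos {C : Matrix ι ι ℂ} (hC : C.PosDef) : 0 < C.det.re :=
  (Complex.pos_iff.mp hC.det_pos).1

theorem PosDef.log_det_re_mul {B C : Matrix ι ι ℂ} (hB : B.PosDef) (hC : C.PosDef) :
    Real.log (B.det * C.det).re = Real.log B.det.re + Real.log C.det.re := by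
  have h := (Complex.pos_iff.mp hB.det_pos).2
  rw [Complex.mul_re, ← h, zero_mul, sub_zero,
    Real.log_mul hB.det_re_pos.ne' hC.det_re_pos.ne']

theorem PosDef.log_det_re_le_smul_add_smul_one {C : Matrix ι ι ℂ} (hC : C.PosDef) {s t : ℝ}
    (hs : 0 < s) (ht : 0 < t) (hst : s + t = 1) :
    s * Real.log C.det.re ≤ Real.log (s • C + t • (1 : Matrix ι ι ℂ)).det.re ∧
      (s * Real.log C.det.re = Real.log (s • C + t • (1 : Matrix ι ι ℂ)).det.re → C = 1) := by
  have hpos := hC.eigenvalues_pos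
  have hdet : C.det = ((∏ i, hC.isHermitian.eigenvalues i : ℝ) : ℂ) := by
    rw [Complex.ofReal_prod]
    exact hC.isHermitian.det_eq_prod_eigenvalues
  have hpos' i : 0 < s * hC.isHermitian.eigenvalues i + t := by
    have := hpos i
    positivity
  have hlt (i) (hi : hC.isHermitian.eigenvalues i ≠ 1) :
      s * Real.log (hC.isHermitian.eigenvalues i) <
        Real.log (s * hC.isHermitian.eigenvalues i + t) := by
    simpa using strictConcaveOn_log_Ioi.2 (hpos i) (Set.mem_Ioi.mpr one_pos) hi hs ht hst
  have hle (i) : s * Real.log (hC.isHermitian.eigenvalues i) ≤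
        Real.log (s * hC.isHermitian.eigenvalues i + t) := by
    by_cases hi : hC.isHermitian.eigenvalues i = 1
    · simp [hi, hst]
    · exact (hlt i hi).le
  rw [hdet, hC.isHermitian.det_smul_add_smul_one, Complex.ofReal_re, Complex.ofReal_re,
    Real.log_prod fun i _ => (hpos i).ne', Real.log_prod fun i _ => (hpos' i).ne',
    Finset.mul_sum]
  refine ⟨Finset.sum_le_sum fun i _ => hle i, fun h => ?_⟩
  rw [Finset.sum_eq_sum_iff_of_le fun i _ => hle i] at h
  exact hC.isHermitian.eq_one_of_eigenvalues fun i =>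
    by_contra fun hi => (hlt i hi).ne (h i (Finset.mem_univ i))

open scoped MatrixOrder in
theorem PosDef.exists_isUnit_eq_star_mul_self {B : Matrix ι ι ℂ} (hB : B.PosDef) :
    ∃ S : Matrix ι ι ℂ, IsUnit S ∧ B = star S * S := by
  obtain ⟨S, rfl⟩ := CStarAlgebra.nonneg_iff_eq_star_mul_self.mp hB.posSemidef.nonneg
  refine ⟨S, ?_, rfl⟩
  have h := hB.isUnit
  rw [isUnit_iff_isUnit_det, det_mul] at h
  exact (isUnit_iff_isUnit_det S).mpr (isUnit_of_mul_isUnit_right h)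

/-- Strict concavity of the log-determinant on Hermitian positive-definite matrices. -/
theorem PosDef.log_det_re_concave {A B : Matrix ι ι ℂ} (hA : A.PosDef) (hB : B.PosDef) {s t : ℝ}
    (hs : 0 < s) (ht : 0 < t) (hst : s + t = 1) :
    s * Real.log A.det.re + t * Real.log B.det.re ≤ Real.log (s • A + t • B).det.re ∧
      (s * Real.log A.det.re + t * Real.log B.det.re = Real.log (s • A + t • B).det.re ↔
        A = B) := by
  obtain ⟨S, hS, rfl⟩ := hB.exists_isUnit_eq_star_mul_self
  obtain ⟨C, rfl⟩ : ∃ C, A = star S * C * S := by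
    lift S to (Matrix ι ι ℂ)ˣ using hS
    refine ⟨star (↑S⁻¹ : Matrix ι ι ℂ) * A * (↑S⁻¹ : Matrix ι ι ℂ), ?_⟩
    simp only [← mul_assoc, ← star_mul, Units.inv_mul, star_one, one_mul]
    simp only [mul_assoc, Units.inv_mul, mul_one]
  have hC : C.PosDef := (IsUnit.posDef_star_left_conjugate_iff hS).mp hA
  have hM : (s • C + t • (1 : Matrix ι ι ℂ)).PosDef := (hC.smul hs).add (PosDef.one.smul ht)
  have hdet (X : Matrix ι ι ℂ) : (star S * X * S).det = (star S * S).det * X.det := by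
    simp only [det_mul]; ring
  have hsum : s • (star S * C * S) + t • (star S * S) =
      star S * (s • C + t • (1 : Matrix ι ι ℂ)) * S := by
    simp [mul_add, add_mul]
  obtain ⟨hle, heq⟩ := hC.log_det_re_le_smul_add_smul_one hs ht hst
  have hlogA : Real.log (star S * C * S).det.re =
      Real.log (star S * S).det.re + Real.log C.det.re := by
    rw [hdet, hB.log_det_re_mul hC]
  have hlogM : Real.log (s • (star S * C * S) + t • (star S * S)).det.re =
      Real.log (star S * S).det.re + Real.log (s • C + t • (1 : Matrix ι ι ℂ)).det.re := by
    rw [hsum, hdet, hB.log_det_re_mul hM]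
  obtain rfl : t = 1 - s := by linarith
  refine ⟨by rw [hlogA, hlogM]; linarith, fun h => ?_, fun h => ?_⟩
  · rw [hlogA, hlogM] at h
    rw [heq (by linarith), mul_one]
  · rw [h, ← add_smul, add_sub_cancel, one_smul]
    ring

end Matrix

/-- The log-det α-diagonality measure of a Hermitian positive-definite matrix is
nonnegative, and vanishes iff the matrix is diagonal. -/
theorem logDet_alpha_diagonality_nonneg (n : ℕ) (α : ℝ) (hα : -1 < α) (hα' : α < 1)
    (A : Matrix (Fin n) (Fin n) ℂ) (hA : A.PosDef)
    (D : ℝ)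
    (hD : D = (4 / (1 - α ^ 2)) *
      Real.log
        (((((1 - α) / 2 : ℝ) • A +
            (((1 + α) / 2 : ℝ)) • Matrix.diagonal (fun i => A i i)).det.re) /
          (A.det.re ^ ((1 - α) / 2) *
            (Matrix.diagonal (fun i => A i i)).det.re ^ ((1 + α) / 2)))) :
    0 ≤ D ∧ (D = 0 ↔ A = Matrix.diagonal fun i => A i i) := by
  have hB : (Matrix.diagonal fun i => A i i).PosDef := Matrix.PosDef.diagonal fun i => hA.diag_pos
  have hs : 0 < (1 - α) / 2 := by linarith
  have ht : 0 < (1 + α) / 2 := by linarith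
  have hM := ((hA.smul hs).add (hB.smul ht)).det_re_pos
  have hAdet := hA.det_re_pos
  have hBdet := hB.det_re_pos
  obtain ⟨hle, heq⟩ := hA.log_det_re_concave hB hs ht (by ring)
  have hc : 0 < 4 / (1 - α ^ 2) := div_pos four_pos (by nlinarith)
  rw [Real.log_div hM.ne' (by positivity), Real.log_mul (by positivity) (by positivity),
    Real.log_rpow hAdet, Real.log_rpow hBdet] at hD
  rw [← heq, hD]
  refine ⟨mul_nonneg hc.le (sub_nonneg.mpr hle), ?_⟩
  rw [mul_eq_zero_iff_left hc.ne', sub_eq_zero, eq_comm]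
end

section
/- Let −1 < α < 1 and let A be an n×n Hermitian positive-definite complex matrix, and let D_α(A) = (4/(1−α²)) log [ det( ((1−α)/2) A + ((1+α)/2) Diag(A) ) / ( (det A)^{(1−α)/2} (det Diag A)^{(1+α)/2} ) ]. Then: (i) for every permutation matrix P one has D_α(P A Pᵀ) = D_α(A); (ii) for every invertible complex diagonal matrix D one has D_α(D A D^H) = D_α(A). In particular D_α(μA) = D_α(A) for every μ > 0. -/
open scoped ComplexOrder Matrix

/-- The log-det α-diagonality measure of an `n × n` Hermitian positive-definite matrix. -/
noncomputable def logDetAlphaDiag (n : ℕ) (α : ℝ) (M : Matrix (Fin n) (Fin n) ℂ) : ℝ :=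
  (4 / (1 - α ^ 2)) *
    Real.log
      (((((1 - α) / 2 : ℝ) • M +
          (((1 + α) / 2 : ℝ)) • Matrix.diagonal (fun i => M i i)).det.re) /
        (M.det.re ^ ((1 - α) / 2) *
          (Matrix.diagonal (fun i => M i i)).det.re ^ ((1 + α) / 2)))

theorem logDetAlphaDiag_eq_of_det_scaled {n : ℕ} {α t : ℝ} {A B : Matrix (Fin n) (Fin n) ℂ}
    (hA : A.PosDef) (ht : 0 < t)
    (hdet : B.det.re = t * A.det.re)
    (hdiag : (Matrix.diagonal (fun i => B i i)).det.re =
      t * (Matrix.diagonal (fun i => A i i)).det.re)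
    (hmix : (((1 - α) / 2 : ℝ) • B +
          (((1 + α) / 2 : ℝ)) • Matrix.diagonal (fun i => B i i)).det.re =
      t * (((1 - α) / 2 : ℝ) • A +
          (((1 + α) / 2 : ℝ)) • Matrix.diagonal (fun i => A i i)).det.re) :
    logDetAlphaDiag n α B = logDetAlphaDiag n α A := by
  have hdetA : 0 < A.det.re := (Complex.pos_iff.mp hA.det_pos).1
  have hdiagA : 0 < (Matrix.diagonal (fun i => A i i)).det.re :=
    (Complex.pos_iff.mp (Matrix.PosDef.diagonal fun _ => hA.diag_pos).det_pos).1
  have hpow : t ^ ((1 - α) / 2) * t ^ ((1 + α) / 2) = t := by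
    rw [← Real.rpow_add ht, show (1 - α) / 2 + (1 + α) / 2 = 1 by ring, Real.rpow_one]
  unfold logDetAlphaDiag
  rw [hdet, hdiag, hmix, Real.mul_rpow ht.le hdetA.le, Real.mul_rpow ht.le hdiagA.le,
    mul_mul_mul_comm, hpow, mul_div_mul_left _ _ ht.ne']

theorem logDetAlphaDiag_submatrix_equiv {n : ℕ} (α : ℝ) {A : Matrix (Fin n) (Fin n) ℂ}
    (hA : A.PosDef) (σ : Equiv.Perm (Fin n)) :
    logDetAlphaDiag n α (A.submatrix σ σ) = logDetAlphaDiag n α A := by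
  have hD : Matrix.diagonal (fun i => A.submatrix σ σ i i) =
      (Matrix.diagonal (fun i => A i i)).submatrix σ σ :=
    (Matrix.submatrix_diagonal_equiv (fun i => A i i) σ).symm
  refine logDetAlphaDiag_eq_of_det_scaled hA one_pos ?_ ?_ ?_
  · rw [Matrix.det_submatrix_equiv_self, one_mul]
  · rw [hD, Matrix.det_submatrix_equiv_self, one_mul]
  · rw [hD, one_mul, ← Matrix.det_submatrix_equiv_self σ (((1 - α) / 2 : ℝ) • A + _)]
    rfl

theorem re_det_mul_mul_conjTranspose {n : ℕ} (D M : Matrix (Fin n) (Fin n) ℂ) :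
    (D * M * Dᴴ).det.re = Complex.normSq D.det * M.det.re := by
  rw [Matrix.det_mul, Matrix.det_mul, Matrix.det_conjTranspose, mul_right_comm, Complex.star_def,
    Complex.mul_conj, Complex.re_ofReal_mul]

theorem logDetAlphaDiag_diagonal_congr {n : ℕ} (α : ℝ) {A : Matrix (Fin n) (Fin n) ℂ}
    (hA : A.PosDef) {d : Fin n → ℂ} (hd : ∀ i, d i ≠ 0) :
    logDetAlphaDiag n α (Matrix.diagonal d * A * (Matrix.diagonal d)ᴴ) =
      logDetAlphaDiag n α A := by
  have hD : Matrix.diagonal (fun i => (Matrix.diagonal d * A * (Matrix.diagonal d)ᴴ) i i) =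
      Matrix.diagonal d * Matrix.diagonal (fun i => A i i) * (Matrix.diagonal d)ᴴ := by
    simp [Matrix.diagonal_conjTranspose, Matrix.diagonal_mul_diagonal]
  have ht : 0 < Complex.normSq (Matrix.diagonal d).det := by
    rw [Complex.normSq_pos, Matrix.det_diagonal]
    exact Finset.prod_ne_zero_iff.mpr fun i _ => hd i
  refine logDetAlphaDiag_eq_of_det_scaled hA ht (re_det_mul_mul_conjTranspose _ _) ?_ ?_
  · rw [hD, re_det_mul_mul_conjTranspose]
  · rw [hD, ← re_det_mul_mul_conjTranspose]
    simp only [Matrix.mul_add, Matrix.add_mul, Matrix.mul_smul, Matrix.smul_mul]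

/-- The log-det α-diagonality measure is invariant under congruence by permutation
matrices and by invertible diagonal matrices; in particular under positive scaling. -/
theorem logDetAlphaDiag_invariance (n : ℕ) (α : ℝ) (hα : -1 < α) (hα' : α < 1)
    (A : Matrix (Fin n) (Fin n) ℂ) (hA : A.PosDef) :
    (∀ σ : Equiv.Perm (Fin n),
        logDetAlphaDiag n α (σ.permMatrix ℂ * A * (σ.permMatrix ℂ)ᵀ) =
          logDetAlphaDiag n α A) ∧
      (∀ d : Fin n → ℂ, (∀ i, d i ≠ 0) →
        logDetAlphaDiag n α (Matrix.diagonal d * A * (Matrix.diagonal d)ᴴ) =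
          logDetAlphaDiag n α A) ∧
      (∀ μ : ℝ, 0 < μ → logDetAlphaDiag n α ((μ : ℂ) • A) = logDetAlphaDiag n α A) := by
  refine ⟨fun σ => ?_, fun d hd => logDetAlphaDiag_diagonal_congr α hA hd, fun μ hμ => ?_⟩
  · have h : σ.permMatrix ℂ * A * (σ.permMatrix ℂ)ᵀ = A.submatrix σ σ := by
      rw [Matrix.transpose_permMatrix, Equiv.Perm.permMatrix, Equiv.Perm.permMatrix,
        PEquiv.toMatrix_toPEquiv_mul, PEquiv.mul_toMatrix_toPEquiv]
      rfl
    rw [h, logDetAlphaDiag_submatrix_equiv α hA σ]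
  · have hs : ((√μ : ℝ) : ℂ) ≠ 0 := Complex.ofReal_ne_zero.mpr (Real.sqrt_pos.mpr hμ).ne'
    rw [← logDetAlphaDiag_diagonal_congr α hA (d := fun _ => ((√μ : ℝ) : ℂ)) fun _ => hs]
    congr 1
    ext i j
    rw [Matrix.diagonal_conjTranspose, Matrix.mul_diagonal, Matrix.diagonal_mul, mul_right_comm]
    simp [← Complex.ofReal_mul, Real.mul_self_sqrt hμ.le]
end

section
/- Let A be an n×n Hermitian positive-definite complex matrix with Â = (Diag A)^{−1/2} A (Diag A)^{−1/2}, and for −1 < α < 1 let D_α(A) = (4/(1−α²)) log [ det( ((1−α)/2) Â + ((1+α)/2) I ) / (det Â)^{(1−α)/2} ]. Then as α → −1⁺, D_α(A) converges to tr(Â⁻¹) − n + log det(Â), and as α → 1⁻, D_α(A) converges to −log det(Â). -/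
open scoped ComplexOrder Matrix

open Matrix Filter Topology

/-- A positive-definite complex matrix is unitarily diagonalizable with positive diagonal. -/
lemma Matrix.PosDef.exists_unitary_diagonalization {n : Type*} [Fintype n] [DecidableEq n]
    {M : Matrix n n ℂ} (hM : M.PosDef) :
    ∃ (U : Matrix n n ℂ) (d : n → ℝ), U * Uᴴ = 1 ∧ (∀ i, 0 < d i) ∧
      M = U * diagonal (fun i => (d i : ℂ)) * Uᴴ := by
  refine ⟨hM.1.eigenvectorUnitary, hM.1.eigenvalues, ?_, hM.eigenvalues_pos, ?_⟩
  · exact Unitary.coe_mul_star_self hM.1.eigenvectorUnitary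
  · have h := hM.1.spectral_theorem
    rw [Unitary.conjStarAlgAut_apply] at h
    exact h

section Diagonalization

variable {n : Type*} [Fintype n] [DecidableEq n] {U : Matrix n n ℂ} {d : n → ℝ}

lemma re_trace_conj_diagonal (hU : U * Uᴴ = 1) :
    (U * diagonal (fun i => (d i : ℂ)) * Uᴴ).trace.re = ∑ i, d i := by
  rw [trace_mul_comm, ← Matrix.mul_assoc, mul_eq_one_comm.mp hU, Matrix.one_mul, trace_diagonal,
    ← Complex.ofReal_sum, Complex.ofReal_re]

lemma re_det_conj_diagonal (hU : U * Uᴴ = 1) :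
    (U * diagonal (fun i => (d i : ℂ)) * Uᴴ).det.re = ∏ i, d i := by
  rw [det_mul_comm, ← Matrix.mul_assoc, mul_eq_one_comm.mp hU, Matrix.one_mul, det_diagonal,
    ← Complex.ofReal_prod, Complex.ofReal_re]

lemma smul_conj_diagonal_add_smul_one (hU : U * Uᴴ = 1) (a b : ℝ) :
    a • (U * diagonal (fun i => (d i : ℂ)) * Uᴴ) + b • (1 : Matrix n n ℂ) =
      U * diagonal (fun i => ((a * d i + b : ℝ) : ℂ)) * Uᴴ := by
  have h : diagonal (fun i => ((a * d i + b : ℝ) : ℂ)) =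
      a • diagonal (fun i => (d i : ℂ)) + b • (1 : Matrix n n ℂ) := by
    ext i j
    by_cases hij : i = j
    · subst hij; simp
    · simp [hij]
  rw [h, Matrix.mul_add, Matrix.add_mul, Matrix.mul_smul, Matrix.smul_mul, Matrix.mul_smul,
    Matrix.smul_mul, Matrix.mul_one, hU]

lemma inv_conj_diagonal (hU : U * Uᴴ = 1) (hd : ∀ i, 0 < d i) :
    (U * diagonal (fun i => (d i : ℂ)) * Uᴴ)⁻¹ =
      U * diagonal (fun i => (((d i)⁻¹ : ℝ) : ℂ)) * Uᴴ := by
  apply inv_eq_right_inv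
  have h : diagonal (fun i => (d i : ℂ)) * diagonal (fun i => (((d i)⁻¹ : ℝ) : ℂ)) = 1 := by
    rw [diagonal_mul_diagonal, ← diagonal_one]
    congr 1
    ext i
    rw [← Complex.ofReal_mul, mul_inv_cancel₀ (hd i).ne', Complex.ofReal_one]
  calc _ = U * diagonal (fun i => (d i : ℂ)) * (Uᴴ * U) *
        diagonal (fun i => (((d i)⁻¹ : ℝ) : ℂ)) * Uᴴ := by simp only [Matrix.mul_assoc]
    _ = 1 := by rw [mul_eq_one_comm.mp hU, Matrix.mul_one, Matrix.mul_assoc U, h, Matrix.mul_one, hU]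

end Diagonalization

/-- The Jensen gap of the logarithm along the segments from `d i` to `1`, summed over `i`. -/
noncomputable def logJensenGap {ι : Type*} [Fintype ι] (d : ι → ℝ) (α : ℝ) : ℝ :=
  ∑ i, (Real.log ((1 - α) / 2 * d i + (1 + α) / 2) - (1 - α) / 2 * Real.log (d i))

section LogJensenGap

variable {ι : Type*} [Fintype ι] {d : ι → ℝ}

lemma logJensenGap_neg_one : logJensenGap d (-1) = 0 := by
  norm_num [logJensenGap]

lemma logJensenGap_one : logJensenGap d 1 = 0 := by
  norm_num [logJensenGap]

lemma hasDerivAt_logJensenGap {α : ℝ} (h : ∀ i, (1 - α) / 2 * d i + (1 + α) / 2 ≠ 0) :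
    HasDerivAt (logJensenGap d)
      (∑ i, ((1 - d i) / 2 / ((1 - α) / 2 * d i + (1 + α) / 2) + Real.log (d i) / 2)) α := by
  unfold logJensenGap
  refine HasDerivAt.fun_sum fun i _ => ?_
  have h1 : HasDerivAt (fun x : ℝ => (1 - x) / 2) (-1 / 2) α :=
    ((hasDerivAt_id α).const_sub 1).div_const 2
  have h2 : HasDerivAt (fun x : ℝ => (1 + x) / 2) (1 / 2) α :=
    ((hasDerivAt_id α).const_add 1).div_const 2
  refine ((((h1.mul_const (d i)).add h2).log (h i)).sub
    (h1.mul_const (Real.log (d i)))).congr_deriv ?_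
  simp only [Pi.add_apply]
  ring

lemma log_prod_div_rpow_eq_logJensenGap (hd : ∀ i, 0 < d i) {α : ℝ}
    (hα : α ∈ Set.Ioo (-1 : ℝ) 1) :
    Real.log ((∏ i, ((1 - α) / 2 * d i + (1 + α) / 2)) / (∏ i, d i) ^ ((1 - α) / 2)) =
      logJensenGap d α := by
  have hp : 0 < ∏ i, d i := Finset.prod_pos fun i _ => hd i
  have hpos : ∀ i, 0 < (1 - α) / 2 * d i + (1 + α) / 2 := fun i =>
    add_pos (mul_pos (by linarith [hα.2]) (hd i)) (by linarith [hα.1])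
  rw [Real.log_div (Finset.prod_pos fun i _ => hpos i).ne' (Real.rpow_pos_of_pos hp _).ne',
    Real.log_rpow hp, Real.log_prod fun i _ => (hpos i).ne', Real.log_prod fun i _ => (hd i).ne',
    logJensenGap, Finset.sum_sub_distrib, Finset.mul_sum]

lemma tendsto_logJensenGap_neg_one (hd : ∀ i, 0 < d i) :
    Tendsto (fun α => 4 / (1 - α ^ 2) * logJensenGap d α) (𝓝[Set.Ioo (-1) 1] (-1))
      (𝓝 (∑ i, (d i)⁻¹ - Fintype.card ι + ∑ i, Real.log (d i))) := by
  have hderiv := hasDerivAt_logJensenGap (d := d) (α := -1) fun i => by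
    have := (hd i).ne'
    norm_num [this]
  have hslope := hderiv.tendsto_slope.mono_left
    (nhdsWithin_mono (-1) fun x (hx : x ∈ Set.Ioo (-1 : ℝ) 1) => hx.1.ne')
  have hc : ContinuousAt (fun α : ℝ => 4 / (1 - α)) (-1) :=
    continuousAt_const.div (by fun_prop) (by norm_num)
  have hlim : 4 / (1 - -1) * ∑ i, ((1 - d i) / 2 / ((1 - -1) / 2 * d i + (1 + -1) / 2) +
      Real.log (d i) / 2) = ∑ i, (d i)⁻¹ - Fintype.card ι + ∑ i, Real.log (d i) := by
    have hcard : (Fintype.card ι : ℝ) = ∑ _i : ι, 1 := by simp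
    rw [hcard, ← Finset.sum_sub_distrib, ← Finset.sum_add_distrib, Finset.mul_sum]
    refine Finset.sum_congr rfl fun i _ => ?_
    have := (hd i).ne'
    norm_num
    field_simp
  rw [← hlim]
  refine ((hc.tendsto.mono_left nhdsWithin_le_nhds).mul hslope).congr' ?_
  filter_upwards with α
  rw [slope_def_field, logJensenGap_neg_one, sub_zero, sub_neg_eq_add, add_comm α 1,
    div_mul_div_comm, show 1 - α ^ 2 = (1 - α) * (1 + α) by ring, div_mul_eq_mul_div]

lemma tendsto_logJensenGap_one :
    Tendsto (fun α => 4 / (1 - α ^ 2) * logJensenGap d α) (𝓝[Set.Ioo (-1) 1] 1)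
      (𝓝 (∑ i, d i - Fintype.card ι - ∑ i, Real.log (d i))) := by
  have hderiv := hasDerivAt_logJensenGap (d := d) (α := 1) fun i => by norm_num
  have hslope := hderiv.tendsto_slope.mono_left
    (nhdsWithin_mono 1 fun x (hx : x ∈ Set.Ioo (-1 : ℝ) 1) => hx.2.ne)
  have hc : ContinuousAt (fun α : ℝ => -4 / (1 + α)) 1 :=
    continuousAt_const.div (by fun_prop) (by norm_num)
  have hlim : -4 / (1 + 1) * ∑ i, ((1 - d i) / 2 / ((1 - 1) / 2 * d i + (1 + 1) / 2) +
      Real.log (d i) / 2) = ∑ i, d i - Fintype.card ι - ∑ i, Real.log (d i) := by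
    have hcard : (Fintype.card ι : ℝ) = ∑ _i : ι, 1 := by simp
    rw [hcard, ← Finset.sum_sub_distrib, ← Finset.sum_sub_distrib, Finset.mul_sum]
    refine Finset.sum_congr rfl fun i _ => ?_
    ring
  rw [← hlim]
  refine ((hc.tendsto.mono_left nhdsWithin_le_nhds).mul hslope).congr' ?_
  filter_upwards with α
  rw [slope_def_field, logJensenGap_one, sub_zero, div_mul_div_comm,
    show 1 - α ^ 2 = -((1 + α) * (α - 1)) by ring, div_neg, neg_mul, neg_mul,
    div_mul_eq_mul_div, neg_div]

end LogJensenGap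

/-- Rescaling a positive-definite matrix by the inverse square roots of its diagonal entries gives a
positive-definite matrix with unit diagonal. -/
lemma Matrix.PosDef.normalize_diagonal {n : Type*} [Fintype n] [DecidableEq n]
    {A S : Matrix n n ℂ} (hA : A.PosDef)
    (hS : S = diagonal fun i => (((Real.sqrt ((A i i).re))⁻¹ : ℝ) : ℂ)) :
    (S * A * S).PosDef ∧ ∀ i, (S * A * S) i i = 1 := by
  have hdiag : ∀ i, 0 < (A i i).re := fun i => (Complex.pos_iff.mp hA.diag_pos).1
  constructor
  · have hSH : Sᴴ = S := by
      rw [hS, diagonal_conjTranspose]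
      congr 1
      ext i
      simp
    have hunit : IsUnit S := by
      rw [hS, isUnit_diagonal, Pi.isUnit_iff]
      intro i
      simpa using (Real.sqrt_pos.mpr (hdiag i)).ne'
    have h := hA.conjTranspose_mul_mul_same (mulVec_injective_of_isUnit hunit)
    rwa [hSH] at h
  · intro i
    have him : A i i = ((A i i).re : ℂ) := (hA.1.coe_re_apply_self i).symm
    rw [hS, mul_diagonal, diagonal_mul, him, Complex.ofReal_re, ← Complex.ofReal_mul,
      ← Complex.ofReal_mul, ← Complex.ofReal_one]
    congr 1
    have hs := Real.sqrt_pos.mpr (hdiag i)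
    field_simp
    exact (Real.sq_sqrt (hdiag i).le).symm

/-- As `α → −1⁺` the log-det α-diagonality measure converges to the right Kullback–Leibler
diagonality measure `tr(Â⁻¹) − n + log det Â`, and as `α → 1⁻` it converges to the left
Kullback–Leibler diagonality measure `−log det Â`. -/
theorem logDet_alpha_diagonality_limits (n : ℕ)
    (A : Matrix (Fin n) (Fin n) ℂ) (hA : A.PosDef)
    (S Ahat : Matrix (Fin n) (Fin n) ℂ)
    (hS : S = Matrix.diagonal fun i => (((Real.sqrt ((A i i).re))⁻¹ : ℝ) : ℂ))
    (hAhat : Ahat = S * A * S) :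
    Filter.Tendsto
        (fun α : ℝ => (4 / (1 - α ^ 2)) *
          Real.log
            (((((1 - α) / 2 : ℝ) • Ahat +
                (((1 + α) / 2 : ℝ)) • (1 : Matrix (Fin n) (Fin n) ℂ)).det.re) /
              Ahat.det.re ^ ((1 - α) / 2)))
        (nhdsWithin (-1) (Set.Ioo (-1 : ℝ) 1))
        (nhds ((Ahat⁻¹).trace.re - (n : ℝ) + Real.log (Ahat.det.re))) ∧
      Filter.Tendsto
        (fun α : ℝ => (4 / (1 - α ^ 2)) *
          Real.log
            (((((1 - α) / 2 : ℝ) • Ahat +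
                (((1 + α) / 2 : ℝ)) • (1 : Matrix (Fin n) (Fin n) ℂ)).det.re) /
              Ahat.det.re ^ ((1 - α) / 2)))
        (nhdsWithin 1 (Set.Ioo (-1 : ℝ) 1))
        (nhds (-Real.log (Ahat.det.re))) := by
  obtain ⟨hpd, hone⟩ := hA.normalize_diagonal hS
  rw [← hAhat] at hpd hone
  have htr : Ahat.trace.re = n := by simp [Matrix.trace, hone]
  obtain ⟨U, d, hU, hd, hM⟩ := hpd.exists_unitary_diagonalization
  have hdet : Ahat.det.re = ∏ i, d i := by rw [hM, re_det_conj_diagonal hU]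
  have hinv : Ahat⁻¹.trace.re = ∑ i, (d i)⁻¹ := by
    rw [hM, inv_conj_diagonal hU hd, re_trace_conj_diagonal hU]
  have hsum : ∑ i, d i = n := by rw [← htr, hM, re_trace_conj_diagonal hU]
  have hlog : Real.log Ahat.det.re = ∑ i, Real.log (d i) := by
    rw [hdet, Real.log_prod fun i _ => (hd i).ne']
  have hgap : ∀ α ∈ Set.Ioo (-1 : ℝ) 1, 4 / (1 - α ^ 2) * logJensenGap d α =
      4 / (1 - α ^ 2) * Real.log
        ((((1 - α) / 2 : ℝ) • Ahat + ((1 + α) / 2 : ℝ) • (1 : Matrix (Fin n) (Fin n) ℂ)).det.re /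
          Ahat.det.re ^ ((1 - α) / 2)) := by
    intro α hα
    rw [hdet, hM, smul_conj_diagonal_add_smul_one hU, re_det_conj_diagonal hU,
      log_prod_div_rpow_eq_logJensenGap hd hα]
  constructor
  · rw [hinv, hlog]
    have h := tendsto_logJensenGap_neg_one hd
    rw [Fintype.card_fin] at h
    exact h.congr' (eventually_nhdsWithin_of_forall hgap)
  · rw [hlog]
    have h := tendsto_logJensenGap_one (d := d)
    rw [Fintype.card_fin, hsum, sub_self, zero_sub] at h
    exact h.congr' (eventually_nhdsWithin_of_forall hgap)
end

section
/- Let A be an n×n Hermitian positive-definite complex matrix. On the set of Hermitian positive-definite diagonal n×n matrices X: (i) the function X ↦ tr(X⁻¹A) − log det(X⁻¹A) − n attains its minimum value 0-characterized uniquely at X = Diag(A), i.e., Diag(A) is its unique minimizer; (ii) the function X ↦ tr(A⁻¹X) − log det(A⁻¹X) − n has unique minimizer X = (Diag(A⁻¹))⁻¹. -/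
open scoped ComplexOrder Matrix

theorem Real.one_le_sub_log {x : ℝ} (hx : 0 < x) : 1 ≤ x - Real.log x := by
  linarith [Real.log_le_sub_one_of_pos hx]

theorem Real.eq_one_of_sub_log_eq_one {x : ℝ} (hx : 0 < x) (h : x - Real.log x = 1) : x = 1 := by
  by_contra hne
  linarith [Real.log_lt_sub_one_of_pos hx hne]

namespace Matrix

variable {ι : Type*} [Fintype ι] [DecidableEq ι]

theorem PosDef.trace_sub_log_det_diagonal_mul {B : Matrix ι ι ℂ} (hB : B.PosDef) {e : ι → ℂ}
    (he : ∀ i, 0 < e i) :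
    (diagonal e * B).trace.re - Real.log (diagonal e * B).det.re =
      ∑ i, ((e i * B i i).re - Real.log (e i * B i i).re) +
        (∑ i, Real.log (B i i).re - Real.log B.det.re) := by
  have hb (i : ι) : 0 < (B i i).re := (Complex.pos_iff.1 hB.diag_pos).1
  have hbim (i : ι) : (B i i).im = 0 := (Complex.pos_iff.1 hB.diag_pos).2.symm
  have hd := Complex.pos_iff.1 hB.det_pos
  have her (i : ι) : 0 < (e i).re := (Complex.pos_iff.1 (he i)).1
  have heq : e = fun i => ((e i).re : ℂ) := by
    ext i
    exact Complex.ext rfl (Complex.pos_iff.1 (he i)).2.symm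
  have hdet : (diagonal e * B).det.re = (∏ i, (e i).re) * B.det.re := by
    rw [det_mul, det_diagonal, heq, ← Complex.ofReal_prod, Complex.re_ofReal_mul]
    simp
  have hmul (i : ι) : (e i * B i i).re = (e i).re * (B i i).re := by
    simp [Complex.mul_re, hbim]
  have hlog (i : ι) :
      Real.log ((e i).re * (B i i).re) = Real.log (e i).re + Real.log (B i i).re :=
    Real.log_mul (her i).ne' (hb i).ne'
  rw [hdet, Real.log_mul (Finset.prod_pos fun i _ => her i).ne' hd.1.ne',
    Real.log_prod fun i _ => (her i).ne']
  simp only [trace, diag_apply, diagonal_mul, Complex.re_sum, hmul, hlog,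
    Finset.sum_sub_distrib, Finset.sum_add_distrib]
  ring

theorem PosDef.inv_diag_minimizes_trace_sub_log_det {B : Matrix ι ι ℂ} (hB : B.PosDef)
    {e : ι → ℂ} (he : ∀ i, 0 < e i) :
    (diagonal (fun i => (B i i)⁻¹) * B).trace.re -
          Real.log (diagonal (fun i => (B i i)⁻¹) * B).det.re ≤
        (diagonal e * B).trace.re - Real.log (diagonal e * B).det.re ∧
      ((diagonal e * B).trace.re - Real.log (diagonal e * B).det.re =
          (diagonal (fun i => (B i i)⁻¹) * B).trace.re -
            Real.log (diagonal (fun i => (B i i)⁻¹) * B).det.re →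
        ∀ i, e i = (B i i)⁻¹) := by
  have hb (i : ι) : 0 < B i i := hB.diag_pos
  have hpos (i : ι) := Complex.pos_iff.1 (mul_pos (he i) (hb i))
  have hone (i : ι) : (B i i)⁻¹ * B i i = 1 := inv_mul_cancel₀ (hb i).ne'
  rw [hB.trace_sub_log_det_diagonal_mul he,
    hB.trace_sub_log_det_diagonal_mul fun i => inv_pos.2 (hb i)]
  simp only [hone, Complex.one_re, Real.log_one, sub_zero, add_le_add_iff_right, add_left_inj]
  have hle : ∀ i ∈ Finset.univ, (1 : ℝ) ≤ (e i * B i i).re - Real.log (e i * B i i).re :=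
    fun i _ => Real.one_le_sub_log (hpos i).1
  refine ⟨Finset.sum_le_sum hle, fun h i => eq_inv_of_mul_eq_one_left ?_⟩
  have hi := (Finset.sum_eq_sum_iff_of_le hle).1 h.symm i (Finset.mem_univ i)
  exact Complex.ext (Real.eq_one_of_sub_log_eq_one (hpos i).1 hi.symm) (hpos i).2.symm

theorem inv_diagonal_of_ne_zero {d : ι → ℂ} (hd : ∀ i, d i ≠ 0) :
    (diagonal d)⁻¹ = diagonal fun i => (d i)⁻¹ := by
  refine inv_eq_left_inv ?_
  rw [diagonal_mul_diagonal, ← diagonal_one]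
  congr 1
  ext i
  exact inv_mul_cancel₀ (hd i)

end Matrix

/-- Over Hermitian positive-definite diagonal matrices `X`:
(i) the Kullback–Leibler divergence `X ↦ tr(X⁻¹A) − log det(X⁻¹A) − n` has unique minimizer
`X = Diag(A)`; (ii) `X ↦ tr(A⁻¹X) − log det(A⁻¹X) − n` has unique minimizer
`X = (Diag(A⁻¹))⁻¹`. -/
theorem KL_closest_diagonal (n : ℕ) (A : Matrix (Fin n) (Fin n) ℂ) (hA : A.PosDef)
    (f g : Matrix (Fin n) (Fin n) ℂ → ℝ)
    (hf : f = fun X => (X⁻¹ * A).trace.re - Real.log ((X⁻¹ * A).det.re) - (n : ℝ))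
    (hg : g = fun X => (A⁻¹ * X).trace.re - Real.log ((A⁻¹ * X).det.re) - (n : ℝ)) :
    (∀ X : Matrix (Fin n) (Fin n) ℂ, X.PosDef → (∃ d : Fin n → ℂ, X = Matrix.diagonal d) →
        f (Matrix.diagonal fun i => A i i) ≤ f X ∧
          (f X = f (Matrix.diagonal fun i => A i i) → X = Matrix.diagonal fun i => A i i)) ∧
      (∀ X : Matrix (Fin n) (Fin n) ℂ, X.PosDef → (∃ d : Fin n → ℂ, X = Matrix.diagonal d) →
        g (Matrix.diagonal fun i => (A⁻¹ i i)⁻¹) ≤ g X ∧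
          (g X = g (Matrix.diagonal fun i => (A⁻¹ i i)⁻¹) →
            X = Matrix.diagonal fun i => (A⁻¹ i i)⁻¹)) := by
  subst hf hg
  refine ⟨?_, ?_⟩
  · rintro X hX ⟨d, rfl⟩
    have hd (i : Fin n) : 0 < d i := Matrix.posDef_diagonal_iff.1 hX i
    have key := hA.inv_diag_minimizes_trace_sub_log_det fun i => inv_pos.2 (hd i)
    simp only [Matrix.inv_diagonal_of_ne_zero fun i => (hd i).ne',
      Matrix.inv_diagonal_of_ne_zero fun i => (hA.diag_pos (i := i)).ne',
      sub_le_sub_iff_right, sub_left_inj]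
    refine ⟨key.1, fun h => ?_⟩
    congr 1
    ext1 i
    exact inv_injective (key.2 h i)
  · rintro X hX ⟨d, rfl⟩
    have key := hA.inv.inv_diag_minimizes_trace_sub_log_det (Matrix.posDef_diagonal_iff.1 hX)
    simp only [Matrix.trace_mul_comm A⁻¹, Matrix.det_mul_comm A⁻¹, sub_le_sub_iff_right,
      sub_left_inj]
    refine ⟨key.1, fun h => ?_⟩
    congr 1
    ext1 i
    exact key.2 h i
end

section
/- Let A be an n×n Hermitian positive-definite complex matrix. On the set of Hermitian positive-definite diagonal n×n matrices X, the function X ↦ (1/2)( tr(X⁻¹A) + tr(A⁻¹X) ) − n (the symmetrized Kullback–Leibler divergence between X and A) has unique minimizer X = (Diag A)^{1/2} (Diag(A⁻¹))^{−1/2}, i.e., the diagonal matrix whose i-th diagonal entry is √( a_{ii} / (A⁻¹)_{ii} ). -/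
open scoped ComplexOrder Matrix

lemma trace_re_inv_diagonal_mul_add {ι : Type*} [Fintype ι] [DecidableEq ι]
    (A B : Matrix ι ι ℂ) {t : ι → ℝ} (ht : ∀ i, 0 < t i) :
    ((Matrix.diagonal fun i => (t i : ℂ))⁻¹ * A).trace.re +
        (B * Matrix.diagonal fun i => (t i : ℂ)).trace.re =
      ∑ i, ((A i i).re / t i + (B i i).re * t i) := by
  have hinv : (Matrix.diagonal fun i => (t i : ℂ))⁻¹ =
      Matrix.diagonal fun i => ((t i)⁻¹ : ℂ) := by
    refine Matrix.inv_eq_right_inv ?_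
    rw [Matrix.diagonal_mul_diagonal, ← Matrix.diagonal_one]
    congr 1
    ext i
    exact mul_inv_cancel₀ (Complex.ofReal_ne_zero.mpr (ht i).ne')
  rw [hinv]
  simp only [Matrix.trace, Matrix.diag_apply, Matrix.diagonal_mul, Matrix.mul_diagonal,
    Complex.re_sum, ← Complex.ofReal_inv, Complex.re_ofReal_mul, Complex.re_mul_ofReal,
    Finset.sum_add_distrib, div_eq_inv_mul]

lemma div_add_mul_sub_sqrt {a b t : ℝ} (ha : 0 < a) (hb : 0 < b) (ht : 0 < t) :
    (a / t + b * t) - (a / √(a / b) + b * √(a / b)) = b * (t - √(a / b)) ^ 2 / t := by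
  obtain ⟨s, hs⟩ : ∃ s, s = √(a / b) := ⟨_, rfl⟩
  have hs0 : 0 < s := hs ▸ Real.sqrt_pos.mpr (div_pos ha hb)
  have has : a = b * s ^ 2 := by
    rw [hs, Real.sq_sqrt (div_pos ha hb).le]
    field_simp
  rw [← hs, has]
  field_simp
  ring

/-- Over Hermitian positive-definite diagonal matrices `X`, the symmetrized
Kullback–Leibler divergence `X ↦ (1/2)(tr(X⁻¹A) + tr(A⁻¹X)) − n` has unique minimizer
the diagonal matrix with entries `√(a_{ii}/(A⁻¹)_{ii})`. -/
theorem symmetrized_KL_closest_diagonal (n : ℕ) (A : Matrix (Fin n) (Fin n) ℂ)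
    (hA : A.PosDef)
    (h : Matrix (Fin n) (Fin n) ℂ → ℝ)
    (hh : h = fun X => (1 / 2 : ℝ) * ((X⁻¹ * A).trace.re + (A⁻¹ * X).trace.re) - (n : ℝ))
    (X₀ : Matrix (Fin n) (Fin n) ℂ)
    (hX₀ : X₀ = Matrix.diagonal fun i => ((Real.sqrt ((A i i).re / ((A⁻¹) i i).re) : ℝ) : ℂ)) :
    ∀ X : Matrix (Fin n) (Fin n) ℂ, X.PosDef → (∃ d : Fin n → ℂ, X = Matrix.diagonal d) →
      h X₀ ≤ h X ∧ (h X = h X₀ → X = X₀) := by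
  rintro X hX ⟨d, rfl⟩
  rw [Matrix.posDef_diagonal_iff] at hX
  obtain ⟨t, rfl⟩ : ∃ t : Fin n → ℝ, d = fun i => (t i : ℂ) :=
    ⟨fun i => (d i).re, funext fun i =>
      Complex.eq_re_of_ofReal_le (r := 0) (by simpa using (hX i).le)⟩
  have ht : ∀ i, 0 < t i := fun i => Complex.zero_lt_real.mp (hX i)
  have ha : ∀ i, 0 < (A i i).re := fun i => (Complex.lt_def.mp hA.diag_pos).1
  have hb : ∀ i, 0 < (A⁻¹ i i).re := fun i => (Complex.lt_def.mp hA.inv.diag_pos).1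
  have key : h (Matrix.diagonal fun i => (t i : ℂ)) - h X₀ =
      (1 / 2) * ∑ i, (A⁻¹ i i).re * (t i - √((A i i).re / (A⁻¹ i i).re)) ^ 2 / t i := by
    simp only [hh, hX₀]
    rw [trace_re_inv_diagonal_mul_add A A⁻¹ ht, trace_re_inv_diagonal_mul_add A A⁻¹
      fun i => Real.sqrt_pos.mpr (div_pos (ha i) (hb i))]
    simp only [← div_add_mul_sub_sqrt (ha _) (hb _) (ht _), Finset.sum_sub_distrib]
    ring
  have hnonneg : ∀ i ∈ Finset.univ,
      0 ≤ (A⁻¹ i i).re * (t i - √((A i i).re / (A⁻¹ i i).re)) ^ 2 / t i := fun i _ =>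
    div_nonneg (mul_nonneg (hb i).le (sq_nonneg _)) (ht i).le
  refine ⟨by linarith [Finset.sum_nonneg hnonneg], fun heq => ?_⟩
  have hzero := (Finset.sum_eq_zero_iff_of_nonneg hnonneg).mp (by linarith)
  rw [hX₀]
  congr 1
  ext i
  have hi := hzero i (Finset.mem_univ i)
  simp only [div_eq_zero_iff, mul_eq_zero, (hb i).ne', (ht i).ne', false_or, or_false,
    pow_eq_zero_iff two_ne_zero, sub_eq_zero] at hi
  rw [hi]
end
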